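/- Let F be an algebraically closed field of characteristic 0 and k ∈ N. Let the orthogonal group O_k(F) act on R = F[y_α : α ∈ N^k] via the identification of y_α with the monomial x^α in F[x_1,...,x_k] (so that functions N^k → F correspond to elements of the dual of F[x_1,...,x_k]). Then the image of the map p : FG → R, p(G)(y) = f_y(G), equals the invariant ring R^{O_k}. -/

import Mathlib

structure MGraph : Type 1 where
  V : Type
  E : Type
  [fintV : Fintype V]
  [fintE : Fintype E]
  [decV : DecidableEq V]
  [decE : DecidableEq E]
  ends : E → V × V

attribute [instance] MGraph.fintV MGraph.fintE MGraph.decV MGraph.decE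

namespace MGraph

/-- multiplicity with which vertex `v` occurs among the endpoints of edge `e`
(a loop counts twice). -/
def inc (G : MGraph) (v : G.V) (e : G.E) : ℕ :=
  (if (G.ends e).1 = v then 1 else 0) + (if (G.ends e).2 = v then 1 else 0)

/-- `κ(δ(v))` : the incidence vector in `ℕ^k` of the multiset of colors seen at `v`. -/
def degVec (G : MGraph) {k : ℕ} (κ : G.E → Fin k) (v : G.V) : Fin k → ℕ :=
  fun c => ∑ e : G.E, if κ e = c then G.inc v e else 0

/-- the partition function of the `k`-color vertex model `y`. -/
def pf {F : Type} [CommRing F] (k : ℕ) (y : (Fin k → ℕ) → F) (G : MGraph) : F :=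
  ∑ κ : G.E → Fin k, ∏ v : G.V, y (G.degVec κ v)

def empty : MGraph where
  V := Empty
  E := Empty
  ends := Empty.elim

def disjUnion (G H : MGraph) : MGraph where
  V := G.V ⊕ H.V
  E := G.E ⊕ H.E
  ends := Sum.elim (fun e => (Sum.inl (G.ends e).1, Sum.inl (G.ends e).2))
    (fun e => (Sum.inr (H.ends e).1, Sum.inr (H.ends e).2))

/-- `G_t` : add the edges `{u t(u) | u ∈ U}`. -/
def addEdges (G : MGraph) (U : Finset G.V) (t : {v // v ∈ U} → G.V) : MGraph where
  V := G.V
  E := G.E ⊕ {v // v ∈ U}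
  ends := Sum.elim G.ends (fun u => (u.1, t u))

/-- `G/t` : add the edges `{u t(u) | u ∈ U}` and contract them. -/
noncomputable def contract (G : MGraph) (U : Finset G.V) (t : {v // v ∈ U} → G.V) : MGraph :=
  letI s : Setoid G.V := Relation.EqvGen.setoid (fun a b => ∃ h : a ∈ U, t ⟨a, h⟩ = b)
  letI : DecidableEq (Quotient s) := Classical.decEq _
  letI : Fintype (Quotient s) := Fintype.ofSurjective (Quotient.mk s)
    (fun q => Quot.exists_rep q)
  { V := Quotient s
    E := G.E
    ends := fun e => (Quotient.mk s (G.ends e).1, Quotient.mk s (G.ends e).2) }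

/-- isomorphism of multigraphs. -/
structure Iso (G H : MGraph) where
  vEquiv : G.V ≃ H.V
  eEquiv : G.E ≃ H.E
  ends_eq : ∀ e, H.ends (eEquiv e) = Prod.map vEquiv vEquiv (G.ends e) ∨
    H.ends (eEquiv e) = (Prod.map vEquiv vEquiv (G.ends e)).swap

end MGraph

open MvPolynomial

/-- the polynomial ring `R = F[y_α : α ∈ ℕ^k]`. -/
abbrev PolyR (F : Type) [CommRing F] (k : ℕ) : Type := MvPolynomial (Fin k → ℕ) F

/-- the partition function of `G` as a polynomial in the variables `y_α`, i.e.
`p(G)(y) = f_y(G)`. -/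
noncomputable def pPoly (F : Type) [CommRing F] (k : ℕ) (G : MGraph) : PolyR F k :=
  ∑ κ : G.E → Fin k, ∏ v : G.V, X (G.degVec κ v)

/-- the linear extension of `p` to formal linear combinations of graphs. -/
noncomputable def pLin (F : Type) [CommRing F] (k : ℕ) : (MGraph →₀ F) →ₗ[F] PolyR F k :=
  Finsupp.linearCombination F (pPoly F k)

/-- the substitution action of a matrix `g` on `F[x_1,…,x_k]` : `x_i ↦ ∑_j g_{j i} x_j`. -/
noncomputable def substAct {F : Type} [CommRing F] {k : ℕ}
    (g : Matrix (Fin k) (Fin k) F) :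
    MvPolynomial (Fin k) F →ₐ[F] MvPolynomial (Fin k) F :=
  aeval (fun i => ∑ j, C (g j i) * X j)

/-- the linear map `F[x_1,…,x_k] → R` sending the monomial `x^α` to the variable `y_α`. -/
noncomputable def monToVar (F : Type) [CommRing F] (k : ℕ)
    (q : MvPolynomial (Fin k) F) : PolyR F k :=
  ∑ d ∈ q.support, C (q.coeff d) * X (⇑d : Fin k → ℕ)

/-- the action of a matrix `g` on `R = F[y_α]` induced from the substitution action on
`F[x_1,…,x_k]` via the identification `y_α ↔ x^α`. -/
noncomputable def gAct {F : Type} [CommRing F] {k : ℕ}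
    (g : Matrix (Fin k) (Fin k) F) : PolyR F k →ₐ[F] PolyR F k :=
  aeval (fun α : Fin k → ℕ => monToVar F k (substAct g (∏ i, X i ^ α i)))

/-- `O_k`-invariance of an element of `R`. -/
def OkInvariant {F : Type} [CommRing F] {k : ℕ} (q : PolyR F k) : Prop :=
  ∀ g : Matrix (Fin k) (Fin k) F, g.transpose * g = 1 → gAct g q = q



namespace FFT
open Matrix

variable {F : Type} [Field F]

def Ag {k : ℕ} {N Z : Type} (A : Set (Z → F)) : Set ((N → Fin k → F) × Z → F) :=
  {h | ∃ a ∈ A, h = fun x => a x.2}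
def coordG (F : Type) [Field F] (k : ℕ) (N Z : Type) : Set ((N → Fin k → F) × Z → F) :=
  {h | ∃ i c, h = fun x => x.1 i c}
def ipG (F : Type) [Field F] (k : ℕ) (N Z : Type) : Set ((N → Fin k → F) × Z → F) :=
  {h | ∃ i j, h = fun x => x.1 i ⬝ᵥ x.1 j}
def zeroG (F : Type) [Field F] (k : ℕ) (N Z : Type) : Set ((N → Fin (k+1) → F) × Z → F) :=
  {h | ∃ i, h = fun x => x.1 i 0}

def BB {k : ℕ} {N Z : Type} (A : Set (Z → F)) : Subalgebra F ((N → Fin k → F) × Z → F) :=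
  Algebra.adjoin F (ipG F k N Z ∪ Ag A)

noncomputable def QQ (F : Type) [Field F] (k : ℕ) : MvPolynomial (Fin k) F := ∑ c, X c * X c

noncomputable def uG {k : ℕ} {N Z : Type} (A : Set (Z → F)) :
    Set ((N → Fin k → F) × Z → MvPolynomial (Fin k) F) :=
  {b | (∃ h ∈ BB A, b = fun x => C (h x)) ∨ (∃ i, b = fun x => ∑ c, C (x.1 i c) * X c) ∨
    b = fun _ => QQ F k}

noncomputable def BU {k : ℕ} {N Z : Type} (A : Set (Z → F)) :
    Subalgebra F ((N → Fin k → F) × Z → MvPolynomial (Fin k) F) :=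
  Algebra.adjoin F (uG A)

noncomputable def gam {k : ℕ} (p q : MvPolynomial (Fin k) F) : MvPolynomial (Fin k) F :=
  ∑ c, pderiv c p * pderiv c q
noncomputable def lap {k : ℕ} (p : MvPolynomial (Fin k) F) : MvPolynomial (Fin k) F :=
  ∑ c, pderiv c (pderiv c p)

lemma gam_comm {k : ℕ} (p q : MvPolynomial (Fin k) F) : gam p q = gam q p := by
  simp [gam, mul_comm]
lemma gam_add {k : ℕ} (p q r : MvPolynomial (Fin k) F) : gam p (q + r) = gam p q + gam p r := by
  simp [gam, mul_add, Finset.sum_add_distrib]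
lemma gam_mul {k : ℕ} (p q r : MvPolynomial (Fin k) F) :
    gam p (q * r) = q * gam p r + r * gam p q := by
  simp only [gam, Finset.mul_sum, ← Finset.sum_add_distrib]
  refine Finset.sum_congr rfl fun c _ => ?_
  simp [Derivation.leibniz]; ring
lemma gam_C {k : ℕ} (p : MvPolynomial (Fin k) F) (a : F) : gam p (C a) = 0 := by
  simp [gam]
lemma lap_add {k : ℕ} (q r : MvPolynomial (Fin k) F) : lap (q + r) = lap q + lap r := by
  simp [lap, Finset.sum_add_distrib]
lemma lap_mul {k : ℕ} (q r : MvPolynomial (Fin k) F) :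
    lap (q * r) = q * lap r + r * lap q + 2 * gam q r := by
  simp only [lap, gam, Finset.mul_sum, ← Finset.sum_add_distrib]
  refine Finset.sum_congr rfl fun c _ => ?_
  simp [Derivation.leibniz]; ring
lemma lap_C {k : ℕ} (a : F) : lap (C a : MvPolynomial (Fin k) F) = 0 := by
  simp [lap]
lemma pd_lin {k : ℕ} (v : Fin k → F) (c : Fin k) :
    pderiv c (∑ c, C (v c) * X c : MvPolynomial (Fin k) F) = C (v c) := by
  classical
  simp [Derivation.leibniz, pderiv_X, Pi.single_apply]
lemma pd_Q {k : ℕ} (c : Fin k) : pderiv c (QQ F k) = 2 * X c := by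
  classical
  simp [QQ, Derivation.leibniz, pderiv_X, Pi.single_apply, Finset.sum_add_distrib]
  ring
lemma lap_lin {k : ℕ} (v : Fin k → F) : lap (∑ c, C (v c) * X c : MvPolynomial (Fin k) F) = 0 := by
  simp only [lap, pd_lin]; simp
lemma pd_2X {k : ℕ} (c : Fin k) : pderiv c (2 * X c : MvPolynomial (Fin k) F) = 2 := by
  rw [← map_ofNat C 2]; simp [Derivation.leibniz]
lemma lap_Q {k : ℕ} : lap (QQ F k) = C (2 * (k : F)) := by
  simp only [lap, pd_Q, pd_2X]; simp [mul_comm, map_ofNat C 2]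
lemma gam_lin_lin {k : ℕ} (v w : Fin k → F) :
    gam (∑ c, C (v c) * X c : MvPolynomial (Fin k) F) (∑ c, C (w c) * X c) = C (v ⬝ᵥ w) := by
  simp only [gam, pd_lin]; simp [dotProduct]
lemma gam_lin_Q {k : ℕ} (v : Fin k → F) :
    gam (∑ c, C (v c) * X c : MvPolynomial (Fin k) F) (QQ F k) = 2 * ∑ c, C (v c) * X c := by
  simp only [gam, pd_lin, pd_Q, Finset.mul_sum]
  refine Finset.sum_congr rfl fun c _ => by ring
lemma gam_Q_Q {k : ℕ} : gam (QQ F k) (QQ F k) = 4 * QQ F k := by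
  simp only [gam, pd_Q]; simp only [QQ, Finset.mul_sum]
  refine Finset.sum_congr rfl fun c _ => by ring

lemma gam_Q_pow {k : ℕ} (m : ℕ) : gam (QQ F k) (QQ F k ^ m) = C (4 * (m : F)) * QQ F k ^ m := by
  induction m with
  | zero => rw [pow_zero, ← C_1, gam_C]; simp
  | succ m ih =>
    rw [pow_succ, gam_mul, ih, gam_Q_Q]; simp [map_ofNat C 4]; ring

lemma lap_Q_pow {k : ℕ} (m : ℕ) :
    lap (QQ F k ^ (m + 1)) = C (2 * ((m : F) + 1) * (2 * m + k)) * QQ F k ^ m := by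
  induction m with
  | zero => simp [lap_Q]
  | succ m ih =>
    rw [pow_succ', lap_mul, ih, gam_Q_pow, lap_Q]; simp [map_ofNat C 4, map_ofNat C 2]; ring

lemma lap_C_mul {k : ℕ} (a : F) (p : MvPolynomial (Fin k) F) : lap (C a * p) = C a * lap p := by
  rw [lap_mul, lap_C, gam_comm, gam_C]; ring

lemma lap_iter [CharZero F] {k : ℕ} (m : ℕ) :
    ∃ c : F, c ≠ 0 ∧ ∀ a : F, lap^[m] (C a * QQ F (k+1) ^ m) = C (c * a) := by
  induction m with
  | zero => exact ⟨1, one_ne_zero, by simp⟩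
  | succ m ih =>
    obtain ⟨c, hc, h⟩ := ih
    refine ⟨c * (2 * ((m : F) + 1) * (2 * m + (k + 1 : ℕ))), ?_, fun a => ?_⟩
    · refine mul_ne_zero hc (mul_ne_zero (mul_ne_zero two_ne_zero ?_) ?_)
      · exact_mod_cast Nat.succ_ne_zero m
      · have : 2 * m + (k + 1) ≠ 0 := by omega
        exact_mod_cast this
    · rw [Function.iterate_succ_apply, lap_C_mul, lap_Q_pow, ← mul_assoc, ← C_mul, h]
      congr 1; ring

section
variable {k : ℕ} {N Z : Type} {A : Set (Z → F)}

lemma BU_C {h : (N → Fin k → F) × Z → F} (hh : h ∈ BB A) : (fun x => C (h x)) ∈ BU A :=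
  Algebra.subset_adjoin (Or.inl ⟨h, hh, rfl⟩)
lemma BU_lin (i : N) : (fun x => ∑ c, C (x.1 i c) * X c) ∈ BU (k := k) A :=
  Algebra.subset_adjoin (Or.inr (Or.inl ⟨i, rfl⟩))
lemma BU_Q : (fun _ => QQ F k) ∈ BU (k := k) (N := N) A :=
  Algebra.subset_adjoin (Or.inr (Or.inr rfl))
lemma BU_const (a : F) : (fun _ => C a) ∈ BU (k := k) (N := N) A :=
  (BU A).algebraMap_mem a

lemma BU_gam {b b' : (N → Fin k → F) × Z → MvPolynomial (Fin k) F}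
    (hb : b ∈ BU A) (hb' : b' ∈ BU A) : (fun x => gam (b x) (b' x)) ∈ BU A := by
  have two : ∀ {b : (N → Fin k → F) × Z → MvPolynomial (Fin k) F} (n : ℕ), b ∈ BU A →
      (fun x => (n : MvPolynomial (Fin k) F) * b x) ∈ BU A := fun n h =>
    mul_mem (natCast_mem (BU A) n) h
  have key : ∀ b ∈ uG (k := k) (N := N) A, ∀ b' ∈ uG (k := k) (N := N) A,
      (fun x => gam (b x) (b' x)) ∈ BU A := by
    have z : (fun _ => 0) ∈ BU (k := k) (N := N) A := zero_mem _
    rintro b (⟨h, hh, rfl⟩ | ⟨i, rfl⟩ | rfl) b' (⟨h', hh', rfl⟩ | ⟨j, rfl⟩ | rfl)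
    · simpa only [gam_C] using z
    · simpa only [gam_comm (C _), gam_C] using z
    · simpa only [gam_comm (C _), gam_C] using z
    · simpa only [gam_C] using z
    · simp only [gam_lin_lin]
      exact BU_C (Algebra.subset_adjoin (Or.inl ⟨i, j, rfl⟩))
    · simp only [gam_lin_Q]
      exact two 2 (BU_lin i)
    · simpa only [gam_C] using z
    · simp only [gam_comm (QQ F k), gam_lin_Q]
      exact two 2 (BU_lin j)
    · simp only [gam_Q_Q]
      exact two 4 BU_Q
  have key2 : ∀ b ∈ uG (k := k) (N := N) A, ∀ b' ∈ BU (k := k) (N := N) A,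
      (fun x => gam (b x) (b' x)) ∈ BU A := by
    intro b hb b' hb'
    induction hb' using Algebra.adjoin_induction with
    | mem x hx => exact key b hb x hx
    | algebraMap r => 
      have z : (fun _ => 0) ∈ BU (k := k) (N := N) A := zero_mem _
      convert z using 2
      exact gam_C _ _
    | add x y hx hy h1 h2 => simp only [Pi.add_apply, gam_add]; exact add_mem h1 h2
    | mul x y hx hy h1 h2 =>
      simp only [Pi.mul_apply, gam_mul]; exact add_mem (mul_mem hx h2) (mul_mem hy h1)
  induction hb using Algebra.adjoin_induction with
  | mem x hx => exact key2 x hx b' hb'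
  | algebraMap r => 
    have z : (fun _ => 0) ∈ BU (k := k) (N := N) A := zero_mem _
    convert z using 2
    rw [gam_comm]
    exact gam_C _ _
  | add x y hx hy h1 h2 =>
    simp only [gam_comm _ (b' _)] at h1 h2 ⊢
    simp only [Pi.add_apply, gam_add]; exact add_mem h1 h2
  | mul x y hx hy h1 h2 =>
    simp only [gam_comm _ (b' _)] at h1 h2 ⊢
    simp only [Pi.mul_apply, gam_mul]; exact add_mem (mul_mem hx h2) (mul_mem hy h1)

lemma BU_lap {b : (N → Fin k → F) × Z → MvPolynomial (Fin k) F}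
    (hb : b ∈ BU A) : (fun x => lap (b x)) ∈ BU A := by
  have z : (fun _ => 0) ∈ BU (k := k) (N := N) A := zero_mem _
  induction hb using Algebra.adjoin_induction with
  | mem x hx =>
    obtain (⟨h, hh, rfl⟩ | ⟨i, rfl⟩ | rfl) := hx
    · simpa only [lap_C] using z
    · simpa only [lap_lin] using z
    · simp only [lap_Q]
      exact BU_const _
  | algebraMap r => 
    convert z using 2
    exact lap_C _
  | add x y hx hy h1 h2 => simp only [Pi.add_apply, lap_add]; exact add_mem h1 h2
  | mul x y hx hy h1 h2 =>
    simp only [Pi.mul_apply, lap_mul]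
    exact add_mem (add_mem (mul_mem hx h2) (mul_mem hy h1))
      (mul_mem (natCast_mem (BU A) 2) (BU_gam hx hy))

lemma BU_lap_iter {b : (N → Fin k → F) × Z → MvPolynomial (Fin k) F}
    (hb : b ∈ BU A) (m : ℕ) : (fun x => lap^[m] (b x)) ∈ BU A := by
  induction m with
  | zero => exact hb
  | succ m ih => simpa only [Function.iterate_succ_apply'] using BU_lap ih

lemma BU_eval {b : (N → Fin k → F) × Z → MvPolynomial (Fin k) F}
    (hb : b ∈ BU A) : (fun x => eval 0 (b x)) ∈ BB A := by
  have z : (fun _ => 0) ∈ BB (k := k) (N := N) A := zero_mem _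
  induction hb using Algebra.adjoin_induction with
  | mem x hx =>
    obtain (⟨h, hh, rfl⟩ | ⟨i, rfl⟩ | rfl) := hx
    · simpa only [eval_C] using hh
    · simpa using z
    · simpa [QQ] using z
  | algebraMap r => 
    convert (BB (k := k) (N := N) A).algebraMap_mem r using 1
    funext x
    exact eval_C _
  | add x y hx hy h1 h2 => simp only [Pi.add_apply, map_add]; exact add_mem h1 h2
  | mul x y hx hy h1 h2 => simp only [Pi.mul_apply, map_mul]; exact mul_mem h1 h2

end

/-- rows of orthogonal matrices -/
lemma exists_orth [CharZero F] {k : ℕ} (u : Fin (k+1) → F) (hu : u ⬝ᵥ u = 1) :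
    ∃ g : Matrix (Fin (k+1)) (Fin (k+1)) F, gᵀ * g = 1 ∧ g 0 = u := by
  have main : ∀ u : Fin (k+1) → F, u ⬝ᵥ u = 1 → u 0 ≠ 1 →
      ∃ g : Matrix (Fin (k+1)) (Fin (k+1)) F, gᵀ * g = 1 ∧ g 0 = u := by
    intro u hu h0
    have h0' : 1 - u 0 ≠ 0 := sub_ne_zero.2 (Ne.symm h0)
    set w : Fin (k+1) → F := u - Pi.single 0 1 with hw
    have hww : w ⬝ᵥ w = 2 * (1 - u 0) := by
      simp [hw, hu]; ring
    refine ⟨1 - (1 - u 0)⁻¹ • vecMulVec w w, ?_, ?_⟩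
    · have ht : (1 - (1 - u 0)⁻¹ • vecMulVec w w)ᵀ = 1 - (1 - u 0)⁻¹ • vecMulVec w w := by
        simp [transpose_vecMulVec]
      have hs : vecMulVec w w * vecMulVec w w = (2 * (1 - u 0)) • vecMulVec w w := by
        rw [vecMulVec_mul_vecMulVec, hww]
        ext i j; simp [vecMulVec_apply]; ring
      rw [ht, sub_mul, mul_sub, mul_sub, smul_mul_smul_comm, hs]
      simp only [one_mul, mul_one, smul_smul]
      have : (1 - u 0)⁻¹ * (1 - u 0)⁻¹ * (2 * (1 - u 0)) = 2 * (1 - u 0)⁻¹ := by field_simp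
      rw [this, two_mul, add_smul]; abel
    · funext j
      have : w 0 = -(1 - u 0) := by simp [hw]
      change (1 : Matrix (Fin (k+1)) (Fin (k+1)) F) 0 j - (1 - u 0)⁻¹ * (w 0 * w j) = u j
      rw [this]
      rw [neg_mul, mul_neg, inv_mul_cancel_left₀ h0']
      simp [hw, one_apply, Pi.single_apply, eq_comm]
  by_cases h0 : u 0 = 1
  · obtain ⟨g, hg, hg0⟩ := main (-u) (by simpa using hu) (by
      simp only [Pi.neg_apply, h0]; norm_num)
    exact ⟨-g, by simpa using hg, by
      change -(g 0) = u
      rw [hg0, neg_neg]⟩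
  · exact main u hu h0

lemma dot_orth {k : ℕ} {g : Matrix (Fin k) (Fin k) F} (hg : gᵀ * g = 1) (v w : Fin k → F) :
    (g *ᵥ v) ⬝ᵥ (g *ᵥ w) = v ⬝ᵥ w := by
  rw [dotProduct_mulVec, vecMul_mulVec, ← dotProduct_mulVec]; simp [hg]

/-- Step A -/
lemma stepA {k : ℕ} {N Z : Type} {A : Set (Z → F)} {h' : (N → Fin k → F) × ((N → F) × Z) → F}
    (A' : Set ((N → F) × Z → F))
    (hA' : A' = {h | (∃ i, h = fun z => z.1 i) ∨ ∃ a ∈ A, h = fun z => a z.2})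
    (hh : h' ∈ BB A') :
    (fun x : (N → Fin (k+1) → F) × Z => h' (fun i => Fin.tail (x.1 i), (fun i => x.1 i 0, x.2))) ∈
      Algebra.adjoin F ((ipG F (k+1) N Z ∪ Ag A) ∪ zeroG F k N Z) := by
  induction hh using Algebra.adjoin_induction with
  | mem x hx =>
    obtain (⟨i, j, rfl⟩ | ⟨a, ha, rfl⟩) := hx
    · have e : (fun x : (N → Fin (k+1) → F) × Z => Fin.tail (x.1 i) ⬝ᵥ Fin.tail (x.1 j)) =
        (fun x => x.1 i ⬝ᵥ x.1 j) - (fun x => x.1 i 0) * (fun x => x.1 j 0) := by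
        funext x
        simp [dotProduct, Fin.sum_univ_succ, Fin.tail]
      simp only [e]
      exact sub_mem (Algebra.subset_adjoin (Or.inl (Or.inl ⟨i, j, rfl⟩)))
        (mul_mem (Algebra.subset_adjoin (Or.inr ⟨i, rfl⟩))
          (Algebra.subset_adjoin (Or.inr ⟨j, rfl⟩)))
    · rw [hA'] at ha
      obtain (⟨i, rfl⟩ | ⟨a, ha, rfl⟩) := ha
      · exact Algebra.subset_adjoin (Or.inr ⟨i, rfl⟩)
      · exact Algebra.subset_adjoin (Or.inl (Or.inr ⟨a, ha, rfl⟩))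
  | algebraMap r => exact Subalgebra.algebraMap_mem _ r
  | add x y hx hy h1 h2 => exact add_mem h1 h2
  | mul x y hx hy h1 h2 => exact mul_mem h1 h2

/-- Step B -/
lemma stepB {k : ℕ} {N Z : Type} {A : Set (Z → F)} {h : (N → Fin (k+1) → F) × Z → F}
    (hh : h ∈ Algebra.adjoin F ((ipG F (k+1) N Z ∪ Ag A) ∪ zeroG F k N Z)) :
    ∃ m : ℕ, ∃ b0 ∈ BU (k := k+1) (N := N) A, ∃ b1 ∈ BU (k := k+1) (N := N) A,
      ∀ (v : N → Fin (k+1) → F) (z : Z) (g : Matrix (Fin (k+1)) (Fin (k+1)) F) (s : F),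
      gᵀ * g = 1 → (s^2)^m * h (fun i => g *ᵥ v i, z) =
        eval (s • g 0) (b0 (v, z)) + s * eval (s • g 0) (b1 (v, z)) := by
  have hQ : ∀ (g : Matrix (Fin (k+1)) (Fin (k+1)) F) (s : F), gᵀ * g = 1 →
      eval (s • g 0) (QQ F (k+1)) = s^2 := by
    intro g s hg
    have h1 : (g * gᵀ) 0 0 = 1 := by rw [mul_eq_one_comm.1 hg]; simp
    rw [mul_apply] at h1
    simp only [transpose_apply] at h1
    simp only [QQ, map_sum, map_mul, eval_X, Pi.smul_apply, smul_eq_mul]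
    rw [← mul_one (s^2), ← h1, Finset.mul_sum]
    exact Finset.sum_congr rfl fun c _ => by ring
  have z0 : (0 : (N → Fin (k+1) → F) × Z → MvPolynomial (Fin (k+1)) F) ∈ BU A := zero_mem _
  induction hh using Algebra.adjoin_induction with
  | mem x hx =>
    obtain ((⟨i, j, rfl⟩ | ⟨a, ha, rfl⟩) | ⟨i, rfl⟩) := hx
    · refine ⟨0, _, BU_C (Algebra.subset_adjoin (Or.inl ⟨i, j, rfl⟩)), _, z0, ?_⟩
      intro v z g s hg
      simp [dot_orth hg]
    · refine ⟨0, _, BU_C (Algebra.subset_adjoin (Or.inr ⟨a, ha, rfl⟩)), _, z0, ?_⟩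
      intro v z g s hg
      simp
    · refine ⟨1, _, z0, _, BU_lin i, ?_⟩
      intro v z g s hg
      simp only [mulVec, dotProduct, Pi.zero_apply, map_zero, map_sum, map_mul, eval_C, eval_X,
        Pi.smul_apply, smul_eq_mul, zero_add, Finset.mul_sum]
      exact Finset.sum_congr rfl fun c _ => by ring
  | algebraMap r =>
    refine ⟨0, _, BU_const r, _, z0, ?_⟩
    intro v z g s hg
    simp
  | add x y hx hy h1 h2 =>
    obtain ⟨m, b0, hb0, b1, hb1, H⟩ := h1
    obtain ⟨n, c0, hc0, c1, hc1, K⟩ := h2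
    refine ⟨m + n, (fun _ => QQ F (k+1))^n * b0 + (fun _ => QQ F (k+1))^m * c0, 
      add_mem (mul_mem (pow_mem BU_Q n) hb0) (mul_mem (pow_mem BU_Q m) hc0),
      (fun _ => QQ F (k+1))^n * b1 + (fun _ => QQ F (k+1))^m * c1, 
      add_mem (mul_mem (pow_mem BU_Q n) hb1) (mul_mem (pow_mem BU_Q m) hc1), ?_⟩
    intro v z g s hg
    have H := H v z g s hg
    have K := K v z g s hg
    simp only [Pi.add_apply, Pi.mul_apply, Pi.pow_apply, map_add, map_mul, map_pow, hQ g s hg]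
    rw [pow_add]
    linear_combination (s^2)^n * H + (s^2)^m * K
  | mul x y hx hy h1 h2 =>
    obtain ⟨m, b0, hb0, b1, hb1, H⟩ := h1
    obtain ⟨n, c0, hc0, c1, hc1, K⟩ := h2
    refine ⟨m + n, b0 * c0 + (fun _ => QQ F (k+1)) * (b1 * c1), 
      add_mem (mul_mem hb0 hc0) (mul_mem BU_Q (mul_mem hb1 hc1)),
      b0 * c1 + b1 * c0, add_mem (mul_mem hb0 hc1) (mul_mem hb1 hc0), ?_⟩
    intro v z g s hg
    have H := H v z g s hg
    have K := K v z g s hg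
    simp only [Pi.add_apply, Pi.mul_apply, map_add, map_mul, hQ g s hg]
    rw [pow_add, mul_mul_mul_comm, H, K]
    ring

theorem fft [IsAlgClosed F] [CharZero F] (k : ℕ) : ∀ (N Z : Type) (A : Set (Z → F))
    (f : (N → Fin k → F) × Z → F), f ∈ Algebra.adjoin F (coordG F k N Z ∪ Ag A) →
    (∀ g : Matrix (Fin k) (Fin k) F, gᵀ * g = 1 → ∀ v z, f (fun i => g *ᵥ v i, z) = f (v, z)) →
    f ∈ BB A := by
  induction k with
  | zero =>
    intro N Z A f hf _
    refine Algebra.adjoin_mono ?_ hf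
    rintro h (⟨i, c, rfl⟩ | h)
    · exact c.elim0
    · exact Or.inr h
  | succ k ih =>
    intro N Z A f hf hinv
    obtain ⟨A', hA'⟩ : ∃ A' : Set ((N → F) × Z → F),
      A' = {h | (∃ i, h = fun z => z.1 i) ∨ ∃ a ∈ A, h = fun z => a z.2} := ⟨_, rfl⟩
    have h1 : (fun x : (N → Fin k → F) × ((N → F) × Z) =>
        f (fun i => Fin.cons (x.2.1 i) (x.1 i), x.2.2)) ∈ BB A' := by
      apply ih
      · clear hinv
        induction hf using Algebra.adjoin_induction with
        | mem x hx =>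
          obtain (⟨i, c, rfl⟩ | ⟨a, ha, rfl⟩) := hx
          · refine Fin.cases ?_ (fun c => ?_) c
            · simp only [Fin.cons_zero]
              exact Algebra.subset_adjoin (Or.inr ⟨_, by rw [hA']; exact Or.inl ⟨i, rfl⟩, rfl⟩)
            · simp only [Fin.cons_succ]
              exact Algebra.subset_adjoin (Or.inl ⟨i, c, rfl⟩)
          · exact Algebra.subset_adjoin (Or.inr ⟨_, by rw [hA']; exact Or.inr ⟨a, ha, rfl⟩, rfl⟩)
        | algebraMap r => exact Subalgebra.algebraMap_mem _ r
        | add x y hx hy h1 h2 => exact add_mem h1 h2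
        | mul x y hx hy h1 h2 => exact mul_mem h1 h2
      · intro g hg v z
        let G : Matrix (Fin (k+1)) (Fin (k+1)) F :=
          Matrix.of (Fin.cons (Fin.cons 1 0) (fun i => Fin.cons 0 (g i)))
        have hG : Gᵀ * G = 1 := by
          ext i j
          have := fun i j => congrFun (congrFun hg i) j
          simp only [mul_apply, transpose_apply, one_apply] at this
          rw [mul_apply, Fin.sum_univ_succ]
          refine Fin.cases ?_ (fun i => ?_) i <;> refine Fin.cases ?_ (fun j => ?_) j <;>
            simp [G, one_apply, this, Fin.succ_ne_zero, (Fin.succ_ne_zero _).symm]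
        have := hinv G hG (fun i => Fin.cons (z.1 i) (v i)) z.2
        rw [← this]
        congr 2
        funext i c
        refine Fin.cases ?_ (fun c => ?_) c <;>
          simp [mulVec, dotProduct, Fin.sum_univ_succ, G]
    have h2 := stepA A' hA' h1
    have h3 : (fun x : (N → Fin (k+1) → F) × Z =>
      f (fun i => Fin.cons (x.1 i 0) (Fin.tail (x.1 i)), x.2)) = f := by
      funext x
      congr 1
      ext i
      · simp only [Fin.cons_self_tail]
      · rfl
    simp only [h3] at h2
    obtain ⟨m, b0, hb0, b1, hb1, H⟩ := stepB h2
    have h4 : ∀ x, C (f x) * QQ F (k+1) ^ m = b0 x := by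
      rintro ⟨v, z⟩
      have hQ0 : QQ F (k+1) ≠ 0 := by
        intro h
        have := congrArg (eval (Pi.single 0 1)) h
        simp [QQ, Pi.single_apply] at this
      refine mul_left_cancel₀ hQ0 (MvPolynomial.funext fun u => ?_)
      rw [map_mul _ (QQ F (k+1)), map_mul _ (QQ F (k+1))]
      by_cases hu : eval u (QQ F (k+1)) = 0
      · rw [hu, zero_mul, zero_mul]
      congr 1
      obtain ⟨s, hs⟩ := IsAlgClosed.exists_pow_nat_eq (eval u (QQ F (k+1))) (n := 2) (by norm_num)
      have hs0 : s ≠ 0 := by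
        rintro rfl; apply hu; rw [← hs]; simp
      obtain ⟨g, hg, hg0⟩ := exists_orth (s⁻¹ • u) (by
        have : u ⬝ᵥ u = s^2 := by rw [hs]; simp [QQ, dotProduct]
        simp [this]; field_simp)
      have e1 := H v z g s hg
      have e2 := H v z (-g) (-s) (by simpa using hg)
      rw [hinv _ hg] at e1
      rw [hinv (-g) (by simpa using hg)] at e2
      have e3 : s • g 0 = u := by rw [hg0, smul_smul, mul_inv_cancel₀ hs0, one_smul]
      have e4 : (-s) • (-g) 0 = u := by rw [← e3]; ext; simp
      rw [e3] at e1
      rw [e4, neg_sq] at e2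
      have : (2 : F) ≠ 0 := two_ne_zero
      rw [map_mul, map_pow, eval_C, ← hs]
      apply mul_left_cancel₀ this
      linear_combination e1 + e2
    obtain ⟨c, hc, hl⟩ := lap_iter (F := F) (k := k) m
    have h5 := BU_eval (BU_lap_iter hb0 m)
    have h6 : (fun x => eval 0 (lap^[m] (b0 x))) = c • f := by
      funext x
      rw [← h4, hl]; simp
    rw [h6] at h5
    have h7 := (BB A).smul_mem h5 c⁻¹
    rwa [smul_smul, inv_mul_cancel₀ hc, one_smul] at h7

end FFT

namespace GraphInv
open FFT

variable {F : Type} [Field F] {k : ℕ} {V : Type} [Fintype V]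

open Classical in
noncomputable def LL (F : Type) [Field F] (k : ℕ) (V : Type) [Fintype V] :
    MvPolynomial ((V × Fin k) ⊕ V) F →ₗ[F] PolyR F k :=
  (basisMonomials _ F).constr F (fun d =>
    if ∀ v, d (Sum.inr v) = 1 then ∏ v, X (fun c => d (Sum.inl (v, c))) else 0)

open Classical in
lemma LL_mon (τ : V → ℕ) (d : V → Fin k → ℕ) :
    LL F k V ((∏ v, X (Sum.inr v) ^ τ v) * ∏ v, ∏ c, X (Sum.inl (v, c)) ^ d v c) =
      if ∀ v, τ v = 1 then ∏ v, X (d v) else 0 := by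
  have e : ((∏ v, X (Sum.inr v) ^ τ v) * ∏ v, ∏ c, X (Sum.inl (v, c)) ^ d v c :
      MvPolynomial ((V × Fin k) ⊕ V) F) = basisMonomials _ F
        (Finsupp.equivFunOnFinite.symm (Sum.elim (fun p => d p.1 p.2) τ)) := by
    rw [coe_basisMonomials]
    beta_reduce
    rw [monomial_eq, Finsupp.prod_fintype _ _ (by simp)]
    rw [Fintype.prod_sum_type, Fintype.prod_prod_type]
    simp [mul_comm]
  rw [e, LL, Module.Basis.constr_basis]
  rfl

lemma edge_mon (G : MGraph) (κ : G.E → Fin k) :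
    (∏ e, (X (Sum.inl ((G.ends e).1, κ e)) * X (Sum.inl ((G.ends e).2, κ e))) :
      MvPolynomial ((G.V × Fin k) ⊕ G.V) F) =
    ∏ v, ∏ c, X (Sum.inl (v, c)) ^ G.degVec κ v c := by
  have : ∀ v, (∏ c, X (Sum.inl (v, c)) ^ G.degVec κ v c :
      MvPolynomial ((G.V × Fin k) ⊕ G.V) F) = ∏ e, X (Sum.inl (v, κ e)) ^ G.inc v e := by
    intro v
    simp only [MGraph.degVec, ← Finset.prod_pow_eq_pow_sum]
    rw [Finset.prod_comm]
    refine Finset.prod_congr rfl fun e _ => ?_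
    simp [pow_ite]
  simp only [this]
  rw [Finset.prod_comm]
  refine Finset.prod_congr rfl fun e _ => ?_
  simp only [MGraph.inc, pow_add, Finset.prod_mul_distrib]
  simp [pow_ite]

open Classical in
lemma LL_edge (G : MGraph) (τ : G.V → ℕ) :
    LL F k G.V ((∏ v, X (Sum.inr v) ^ τ v) *
      ∏ e, ∑ c, X (Sum.inl ((G.ends e).1, c)) * X (Sum.inl ((G.ends e).2, c))) =
    if ∀ v, τ v = 1 then pPoly F k G else 0 := by
  rw [Finset.prod_univ_sum, Fintype.piFinset_univ, Finset.mul_sum, map_sum]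
  simp only [edge_mon, LL_mon]
  split_ifs with h
  · rfl
  · simp

noncomputable def MM (F : Type) [Field F] (k : ℕ) (V : Type) [Fintype V] :
    MvPolynomial (V × Fin k) F →ₗ[F] PolyR F k :=
  LL F k V ∘ₗ LinearMap.mulLeft F (∏ v, X (Sum.inr v)) ∘ₗ (rename Sum.inl).toLinearMap

lemma MM_mon (d : V → Fin k → ℕ) :
    MM F k V (∏ v, ∏ c, X (v, c) ^ d v c) = ∏ v, X (d v) := by
  have := LL_mon (F := F) (fun _ : V => 1) d
  simp only [pow_one, implies_true, if_true] at this
  rw [← this]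
  simp [MM]

lemma MM_edge (G : MGraph) :
    MM F k G.V (∏ e, ∑ c, X ((G.ends e).1, c) * X ((G.ends e).2, c)) = pPoly F k G := by
  have := LL_edge (F := F) (k := k) G (fun _ => 1)
  simp only [pow_one, implies_true, if_true] at this
  rw [← this]
  simp [MM]

lemma MM_prod (p : V → MvPolynomial (Fin k) F) :
    MM F k V (∏ v, rename (Prod.mk v) (p v)) = ∏ v, monToVar F k (p v) := by
  classical
  have e : ∀ v, rename (Prod.mk v) (p v) =
      ∑ d ∈ (p v).support, C ((p v).coeff d) * ∏ c, X (v, c) ^ d c := by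
    intro v
    conv_lhs => rw [(p v).as_sum]
    rw [map_sum]
    refine Finset.sum_congr rfl fun d _ => ?_
    rw [monomial_eq, Finsupp.prod_fintype _ _ (by simp)]
    simp
  simp only [e, monToVar]
  rw [Finset.prod_univ_sum, Finset.prod_univ_sum, map_sum]
  refine Finset.sum_congr rfl fun d _ => ?_
  rw [Finset.prod_mul_distrib, Finset.prod_mul_distrib, ← map_prod, ← map_prod,
    ← smul_eq_C_mul, ← smul_eq_C_mul, map_smul, MM_mon]

noncomputable def Psi (V : Type) (h : Matrix (Fin k) (Fin k) F) :
    MvPolynomial (V × Fin k) F →ₐ[F] MvPolynomial (V × Fin k) F :=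
  aeval (fun p => ∑ j, C (h j p.2) * X (p.1, j))

lemma gAct_MM (h : Matrix (Fin k) (Fin k) F) (p : MvPolynomial (V × Fin k) F) :
    gAct h (MM F k V p) = MM F k V (Psi V h p) := by
  induction p using MvPolynomial.induction_on' with
  | add p q hp hq => simp only [map_add, hp, hq]
  | monomial u a =>
    rw [monomial_eq, Finsupp.prod_fintype _ _ (by simp), ← smul_eq_C_mul, map_smul, map_smul,
      map_smul, map_smul]
    congr 1
    rw [Fintype.prod_prod_type]
    have := MM_mon (F := F) (fun (v : V) c => u (v, c))
    rw [this]
    simp only [map_prod, gAct, aeval_X]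
    rw [← MM_prod]
    congr 1
    refine Finset.prod_congr rfl fun v _ => ?_
    simp [Psi, substAct]

lemma forward (G : MGraph) (h : Matrix (Fin k) (Fin k) F) (hh : h.transpose * h = 1) :
    gAct h (pPoly F k G) = pPoly F k G := by
  rw [← MM_edge, gAct_MM]
  congr 1
  rw [map_prod]
  refine Finset.prod_congr rfl fun e _ => ?_
  have hh' := mul_eq_one_comm.1 hh
  have h2 : ∀ i j, ∑ c, h i c * h j c = if i = j then 1 else 0 := by
    intro i j
    have := congrFun (congrFun hh' i) j
    simpa [Matrix.mul_apply, Matrix.one_apply] using this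
  simp only [map_sum, map_mul, Psi, aeval_X, Finset.sum_mul_sum]
  rw [Finset.sum_comm]
  refine Finset.sum_congr rfl fun i _ => ?_
  rw [Finset.sum_comm]
  have : ∀ j, ∑ c, (C (h i c) * X ((G.ends e).1, i)) * (C (h j c) * X ((G.ends e).2, j)) =
      C (∑ c, h i c * h j c) * (X ((G.ends e).1, i) * X ((G.ends e).2, j)) := by
    intro j
    rw [map_sum, Finset.sum_mul]
    refine Finset.sum_congr rfl fun c _ => ?_
    rw [C_mul]; ring
  simp only [this, h2]
  simp

noncomputable def Phi (F : Type) [Field F] (k : ℕ) (V : Type) [Fintype V] :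
    PolyR F k →ₐ[F] MvPolynomial ((V × Fin k) ⊕ V) F :=
  aeval (fun α => ∑ v, X (Sum.inr v) * ∏ c, X (Sum.inl (v, c)) ^ α c)

def pt (x : (V → Fin k → F) × (V → F)) : (V × Fin k) ⊕ V → F :=
  Sum.elim (fun p => x.1 p.1 p.2) x.2

noncomputable def ev (F : Type) [Field F] (k : ℕ) (V : Type) :
    MvPolynomial ((V × Fin k) ⊕ V) F →ₐ[F] ((V → Fin k → F) × (V → F) → F) :=
  AlgHom.pi (fun x => aeval (Sum.elim (fun p => x.1 p.1 p.2) x.2))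

lemma ev_apply (p : MvPolynomial ((V × Fin k) ⊕ V) F) (x) :
    ev F k V p x = aeval (Sum.elim (fun p => x.1 p.1 p.2) x.2) p := rfl

lemma ev_inj [CharZero F] : Function.Injective (ev F k V) := by
  intro p q h
  refine MvPolynomial.funext fun w => ?_
  have := congrFun h (fun v c => w (Sum.inl (v, c)), fun v => w (Sum.inr v))
  simp only [ev_apply] at this
  have e : (Sum.elim (fun p : V × Fin k => w (Sum.inl (p.1, p.2))) fun v => w (Sum.inr v)) = w := by
    funext s; cases s <;> rfl
  rw [e] at this
  simpa [aeval_eq_eval] using this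

lemma ev_monToVar (p : MvPolynomial (Fin k) F) (x : (V → Fin k → F) × (V → F)) :
    ev F k V (Phi F k V (monToVar F k p)) x = ∑ v, x.2 v * eval (x.1 v) p := by
  simp only [monToVar, map_sum, map_mul, Phi, aeval_X, eval_eq', ev_apply, Finset.mul_sum,
    map_prod, map_pow, Sum.elim_inl, Sum.elim_inr, algHom_C]
  rw [Finset.sum_comm]
  refine Finset.sum_congr rfl fun v _ => Finset.sum_congr rfl fun d _ => ?_
  simp
  ring

lemma ev_gAct (h : Matrix (Fin k) (Fin k) F) (q : PolyR F k) (x : (V → Fin k → F) × (V → F)) :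
    ev F k V (Phi F k V (gAct h q)) x =
      ev F k V (Phi F k V q) (fun i => h.transpose.mulVec (x.1 i), x.2) := by
  have : (((Pi.evalAlgHom F _ x).comp (ev F k V)).comp (Phi F k V)).comp (gAct h) =
    ((Pi.evalAlgHom F _ (fun i => h.transpose.mulVec (x.1 i), x.2)).comp (ev F k V)).comp
      (Phi F k V) := by
    refine MvPolynomial.algHom_ext fun α => ?_
    simp only [AlgHom.comp_apply, Pi.evalAlgHom_apply, gAct, aeval_X]
    rw [ev_monToVar]
    simp [Phi, ev_apply, substAct, Matrix.mulVec, dotProduct, map_sum]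
  exact DFunLike.congr_fun this q

lemma ev_inv (q : PolyR F k) (hq : OkInvariant q) (g : Matrix (Fin k) (Fin k) F)
    (hg : g.transpose * g = 1) (v : V → Fin k → F) (z : V → F) :
    ev F k V (Phi F k V q) (fun i => g.mulVec (v i), z) = ev F k V (Phi F k V q) (v, z) := by
  have := ev_gAct g.transpose q (v, z)
  rw [hq g.transpose (by simpa using mul_eq_one_comm.1 hg)] at this
  simpa using this.symm

def AA (F : Type) (V : Type) : Set ((V → F) → F) := {a | ∃ v, a = fun z => z v}

def genS (F : Type) [Field F] (k : ℕ) (V : Type) : Set (MvPolynomial ((V × Fin k) ⊕ V) F) :=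
  {p | (∃ i j, p = ∑ c, X (Sum.inl (i, c)) * X (Sum.inl (j, c))) ∨ ∃ v, p = X (Sum.inr v)}

lemma ev_coord (p : MvPolynomial ((V × Fin k) ⊕ V) F) :
    ev F k V p ∈ Algebra.adjoin F (coordG F k V (V → F) ∪ Ag (AA F V)) := by
  induction p using MvPolynomial.induction_on with
  | C a =>
    have : ev F k V (C a) = algebraMap F _ a := (ev F k V).commutes a
    rw [this]; exact Subalgebra.algebraMap_mem _ a
  | add p q hp hq => rw [map_add]; exact add_mem hp hq
  | mul_X p s hp =>
    rw [map_mul]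
    refine mul_mem hp (Algebra.subset_adjoin ?_)
    cases s with
    | inl s => exact Or.inl ⟨s.1, s.2, by funext x; simp [ev_apply]⟩
    | inr s => exact Or.inr ⟨_, ⟨s, rfl⟩, by funext x; simp [ev_apply]⟩

lemma Phi_mem [IsAlgClosed F] [CharZero F] (q : PolyR F k) (hq : OkInvariant q) :
    Phi F k V q ∈ Algebra.adjoin F (genS F k V) := by
  have h := fft k V (V → F) (AA F V) _ (ev_coord (Phi F k V q)) (ev_inv q hq)
  have h2 : BB (AA F V) ≤ (Algebra.adjoin F (genS F k V)).map (ev F k V) := by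
    rw [AlgHom.map_adjoin]
    refine Algebra.adjoin_mono ?_
    rintro h (⟨i, j, rfl⟩ | ⟨a, ⟨v, rfl⟩, rfl⟩)
    · refine ⟨_, Or.inl ⟨i, j, rfl⟩, ?_⟩
      funext x
      simp [ev_apply, dotProduct]
    · refine ⟨_, Or.inr ⟨v, rfl⟩, ?_⟩
      funext x
      simp [ev_apply]
  obtain ⟨p, hp, e⟩ := h2 h
  rw [← ev_inj e]
  exact hp

lemma LL_mem [DecidableEq V] (p : MvPolynomial ((V × Fin k) ⊕ V) F)
    (hp : p ∈ Algebra.adjoin F (genS F k V)) : LL F k V p ∈ LinearMap.range (pLin F k) := by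
  rw [← Subalgebra.mem_toSubmodule, Algebra.adjoin_eq_span] at hp
  induction hp using Submodule.span_induction with
  | zero => rw [map_zero]; exact zero_mem _
  | add x y _ _ hx hy => rw [map_add]; exact add_mem hx hy
  | smul a x _ hx => rw [map_smul]; exact Submodule.smul_mem _ _ hx
  | mem x hx =>
    have : ∃ (τ : V → ℕ) (n : ℕ) (ends : Fin n → V × V), x = (∏ v, X (Sum.inr v) ^ τ v) *
      ∏ e, ∑ c, X (Sum.inl ((ends e).1, c)) * X (Sum.inl ((ends e).2, c)) := by
      induction hx using Submonoid.closure_induction_left with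
      | one => exact ⟨0, 0, Fin.elim0, by simp⟩
      | mul_left x hx y hy ih =>
        obtain ⟨τ, n, ends, rfl⟩ := ih
        obtain (⟨i, j, rfl⟩ | ⟨v, rfl⟩) := hx
        · refine ⟨τ, n + 1, Fin.cons (i, j) ends, ?_⟩
          rw [Fin.prod_univ_succ]
          simp only [Fin.cons_zero, Fin.cons_succ]
          ring
        · refine ⟨τ + Pi.single v 1, n, ends, ?_⟩
          simp only [Pi.add_apply, pow_add, Finset.prod_mul_distrib, Pi.single_apply, pow_ite]
          simp
          ring
    obtain ⟨τ, n, ends, rfl⟩ := this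
    have := LL_edge (F := F) (k := k) (MGraph.mk V (Fin n) ends) τ
    have h2 : LL F k V _ = _ := this
    rw [h2]
    split_ifs
    · exact ⟨Finsupp.single (MGraph.mk V (Fin n) ends) 1, by simp [pLin]⟩
    · exact zero_mem _

lemma LL_Phi_prod (n r : ℕ) (α : Fin r → (Fin k → ℕ)) :
    LL F k (Fin n) (Phi F k (Fin n) (∏ j, X (α j))) =
      if r = n then (n.factorial : F) • ∏ j, X (α j) else 0 := by
  classical
  rw [map_prod]
  simp only [Phi, aeval_X]
  rw [Finset.prod_univ_sum, Fintype.piFinset_univ, map_sum]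
  have e : ∀ w : Fin r → Fin n, LL F k (Fin n)
      (∏ j, (X (Sum.inr (w j)) * ∏ c, X (Sum.inl (w j, c)) ^ α j c)) =
      if Function.Bijective w then ∏ j, X (α j) else 0 := by
    intro w
    have e1 : (∏ j, (X (Sum.inr (w j)) * ∏ c, X (Sum.inl (w j, c)) ^ α j c) :
        MvPolynomial ((Fin n × Fin k) ⊕ Fin n) F) =
        (∏ v, X (Sum.inr v) ^ (∑ j, if w j = v then 1 else 0)) *
        ∏ v, ∏ c, X (Sum.inl (v, c)) ^ (∑ j, if w j = v then α j c else 0) := by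
      rw [Finset.prod_mul_distrib]
      simp only [← Finset.prod_pow_eq_pow_sum]
      congr 1
      · rw [Finset.prod_comm]
        simp [pow_ite]
      · have : ∀ v : Fin n, (∏ c, ∏ j, X (Sum.inl (v, c)) ^ (if w j = v then α j c else 0) :
          MvPolynomial ((Fin n × Fin k) ⊕ Fin n) F) =
          ∏ j, if w j = v then ∏ c, X (Sum.inl (v, c)) ^ α j c else 1 := by
          intro v
          rw [Finset.prod_comm]
          refine Finset.prod_congr rfl fun j _ => ?_
          split_ifs <;> simp
        simp only [this]
        conv_rhs => rw [Finset.prod_comm]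
        simp
    rw [e1, LL_mon]
    have hb : (∀ v, (∑ j, if w j = v then 1 else 0) = 1) ↔ Function.Bijective w := by
      rw [Function.bijective_iff_existsUnique]
      refine forall_congr' fun v => ?_
      rw [← Finset.card_filter, Finset.card_eq_one]
      constructor
      · rintro ⟨a, ha⟩
        refine ⟨a, ?_, fun b hb => ?_⟩
        · have : a ∈ ({a} : Finset (Fin r)) := by simp
          rw [← ha] at this; simpa using this
        · have : b ∈ Finset.univ.filter (fun j => w j = v) := by simpa using hb
          rw [ha] at this; simpa using this
      · rintro ⟨a, ha, hu⟩
        refine ⟨a, ?_⟩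
        ext b
        simp only [Finset.mem_filter, Finset.mem_univ, true_and, Finset.mem_singleton]
        exact ⟨hu b, by rintro rfl; exact ha⟩
    simp only [hb]
    split_ifs with h
    · symm
      refine Fintype.prod_bijective w h _ _ fun j => ?_
      congr 1
      funext c
      simp [h.1.eq_iff]
    · rfl
  simp only [e]
  rw [← Finset.sum_filter, Finset.sum_const]
  split_ifs with h
  · subst h
    have : (Finset.univ.filter fun w : Fin r → Fin r => Function.Bijective w).card
        = r.factorial := by
      rw [← Fintype.card_subtype, ← Fintype.card_congr (Equiv.ofBijective
        (fun e : Equiv.Perm (Fin r) => (⟨e, e.bijective⟩ : {w // Function.Bijective w})) ?_),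
        Fintype.card_perm, Fintype.card_fin]
      refine ⟨fun a b hab => ?_, fun w => ⟨Equiv.ofBijective w.1 w.2, ?_⟩⟩
      · exact DFunLike.coe_injective (congrArg Subtype.val hab)
      · ext; rfl
    rw [this, Nat.cast_smul_eq_nsmul]
  · have : (Finset.univ.filter fun w : Fin r → Fin n => Function.Bijective w) = ∅ := by
      ext w
      simp only [Finset.mem_filter, Finset.mem_univ, true_and, Finset.notMem_empty, iff_false]
      intro hw
      exact h (by simpa using Fintype.card_of_bijective hw)
    rw [this]; simp

lemma LL_Phi (n : ℕ) (q : PolyR F k) :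
    LL F k (Fin n) (Phi F k (Fin n) q) = (n.factorial : F) • homogeneousComponent n q := by
  classical
  induction q using MvPolynomial.induction_on' with
  | add p q hp hq => simp only [map_add, hp, hq, smul_add]
  | monomial u a =>
    have e0 : monomial u a = a • (monomial u 1 : PolyR F k) := by simp [smul_monomial]
    rw [e0]
    simp only [map_smul]
    rw [smul_comm]
    congr 1
    obtain ⟨l, hl⟩ := Quot.exists_rep (Finsupp.toMultiset u)
    have e1 : (monomial u 1 : PolyR F k) = ∏ j : Fin l.length, X (l.get j) := by
      have : (monomial u 1 : PolyR F k) = ((Finsupp.toMultiset u).map X).prod := by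
        rw [monomial_eq, Finsupp.toMultiset_map, Finsupp.prod_toMultiset,
          Finsupp.prod_mapDomain_index (fun _ => pow_zero _) (fun _ _ _ => pow_add _ _ _)]
        simp
      rw [this, ← hl]
      simp [List.prod_ofFn]
    have e2 : u.degree = l.length := by
      have := Finsupp.card_toMultiset u
      rw [← hl] at this
      rw [Finsupp.degree_apply]
      exact this.symm
    have e3 : (∏ j : Fin l.length, X (l.get j) : PolyR F k).IsHomogeneous l.length := by
      rw [← e1, ← e2]; exact isHomogeneous_monomial _ rfl
    rw [e1, LL_Phi_prod]
    rw [homogeneousComponent_of_mem ((mem_homogeneousSubmodule _ _).2 e3)]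
    simp only [eq_comm (a := n)]
    split_ifs <;> simp

end GraphInv

open GraphInv in
/-- the image of the partition-function map `p : FG → R` is exactly the
ring of `O_k`-invariants of `R` (for `F` algebraically closed of characteristic 0). -/
theorem range_pLin_eq_invariants (F : Type) [Field F] [IsAlgClosed F] [CharZero F] (k : ℕ) :
    Set.range ⇑(pLin F k) = {q : PolyR F k | OkInvariant q} := by
  ext q
  constructor
  · rintro ⟨f, rfl⟩ g hg
    rw [pLin, Finsupp.linearCombination_apply, Finsupp.sum, map_sum]
    refine Finset.sum_congr rfl fun G _ => ?_
    rw [map_smul, forward G g hg]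
  · intro hq
    change q ∈ LinearMap.range (pLin F k)
    rw [← sum_homogeneousComponent q]
    refine Submodule.sum_mem _ fun n _ => ?_
    have h := LL_mem _ (Phi_mem (V := Fin n) q hq)
    rw [LL_Phi] at h
    have h2 := Submodule.smul_mem _ ((n.factorial : F)⁻¹) h
    rwa [smul_smul, inv_mul_cancel₀ (by exact_mod_cast n.factorial_ne_zero), one_smul] at h2
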